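/- Two q-tame graded barcodes lie in the same connected component of the space of q-tame graded barcodes (with the bottleneck distance) if and only if they have the same number of semi-infinite bars in each degree. Moreover, each connected component is path-connected. -/

import Mathlib

open scoped Classical
noncomputable section

/-- A bar: a pair `(a, b)` representing the interval `(a, b]` (with `b = ⊤` for `(a, ∞)`). -/
abbrev Bar : Type := ℝ × EReal

namespace Bar

/-- The interval `(a,b]` is nonempty. -/
def IsValid (I : Bar) : Prop := (I.1 : EReal) < I.2

/-- The length of a bar. -/
def len (I : Bar) : EReal := I.2 - (I.1 : EReal)

/-- A bar is semi-infinite if its right endpoint is `+∞`. -/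
def IsInf (I : Bar) : Prop := I.2 = ⊤

end Bar

/-- `I ⊆ J^{-δ}`, where `(a,b]^{-δ} = (a-δ, b+δ]`. -/
def barSub (I J : Bar) (δ : ℝ) : Prop :=
  J.1 - δ ≤ I.1 ∧ I.2 ≤ J.2 + (δ : EReal)

/-- A barcode: a multiset of nonempty intervals of the form `(a,b]` or `(a,∞)`,
recorded by its multiplicity function. -/
structure Barcode where
  mult : Bar → ℕ
  valid : ∀ I, mult I ≠ 0 → I.IsValid

namespace Barcode

/-- `m` is a `δ`-matching between the barcodes `B` and `B'`: it matches `m I J` copies of the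
bar `I` of `B` with copies of the bar `J` of `B'`; matched bars must be `δ`-close, and
unmatched (deleted) bars must have length at most `2δ`. -/
def IsMatching (B B' : Barcode) (δ : ℝ) (m : Bar → Bar → ℕ) : Prop :=
  (∀ I, {J | m I J ≠ 0}.Finite) ∧
  (∀ J, {I | m I J ≠ 0}.Finite) ∧
  (∀ I, ∑ᶠ J, m I J ≤ B.mult I) ∧
  (∀ J, ∑ᶠ I, m I J ≤ B'.mult J) ∧
  (∀ I, ∑ᶠ J, m I J < B.mult I → I.len ≤ ((2 * δ : ℝ) : EReal)) ∧
  (∀ J, ∑ᶠ I, m I J < B'.mult J → J.len ≤ ((2 * δ : ℝ) : EReal)) ∧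
  (∀ I J, m I J ≠ 0 → barSub I J δ ∧ barSub J I δ)

/-- `B` and `B'` admit a `δ`-matching. -/
def HasMatching (B B' : Barcode) (δ : ℝ) : Prop := ∃ m, IsMatching B B' δ m

/-- The bottleneck distance between two barcodes. -/
def bottleneck (B B' : Barcode) : EReal :=
  sInf {x : EReal | ∃ δ : ℝ, 0 ≤ δ ∧ x = (δ : EReal) ∧ HasMatching B B' δ}

/-- A barcode is finite if it has finitely many bars counted with multiplicity. -/
def IsFinite (B : Barcode) : Prop := {I | B.mult I ≠ 0}.Finite

/-- A barcode is q-tame if for every `ε > 0` it has finitely many bars of length `≥ ε`. -/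
def QTame (B : Barcode) : Prop :=
  ∀ ε : ℝ, 0 < ε → {I | B.mult I ≠ 0 ∧ (ε : EReal) ≤ I.len}.Finite

end Barcode

/-- A ℤ-graded barcode. -/
def GradedBarcode := ℤ → Barcode

namespace GradedBarcode

/-- A graded barcode is q-tame if for every `ε > 0` only finitely many bars (over all degrees)
have length `≥ ε`. -/
def QTame (B : GradedBarcode) : Prop :=
  ∀ ε : ℝ, 0 < ε → {p : ℤ × Bar | (B p.1).mult p.2 ≠ 0 ∧ (ε : EReal) ≤ p.2.len}.Finite

/-- The number of semi-infinite bars of `B` in degree `n`, counted with multiplicity. -/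
def sigmaInf (B : GradedBarcode) (n : ℤ) : ℕ :=
  ∑ᶠ (I : Bar) (_ : I.IsInf), (B n).mult I

/-- The graded bottleneck distance: supremum over the degrees of the degreewise
bottleneck distances. -/
def dist (B B' : GradedBarcode) : EReal :=
  ⨆ n : ℤ, Barcode.bottleneck (B n) (B' n)

end GradedBarcode

/-- The space of q-tame graded barcodes. -/
def QTGB : Type := {B : GradedBarcode // B.QTame}

/-- The topology induced by the graded bottleneck distance. -/
instance : TopologicalSpace QTGB :=
  TopologicalSpace.generateFrom
    {s | ∃ (B : QTGB) (ε : ℝ), 0 < ε ∧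
      s = {B' : QTGB | GradedBarcode.dist B.1 B'.1 < (ε : EReal)}}

lemma coupling_multiset {α β : Type*} (s : Multiset α) :
    ∀ t : Multiset β, s.card ≤ t.card →
      ∃ c : Multiset (α × β), c.map Prod.fst = s ∧ c.map Prod.snd ≤ t := by
  induction s using Multiset.induction with
  | empty => intro t _; exact ⟨0, by simp, by simp⟩
  | cons a s ih =>
    intro t ht
    have : 0 < t.card := by
      rw [Multiset.card_cons] at ht; omega
    obtain ⟨b, hb⟩ := Multiset.card_pos_iff_exists_mem.1 this
    obtain ⟨t', rfl⟩ := Multiset.exists_cons_of_mem hb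
    simp only [Multiset.card_cons] at ht
    obtain ⟨c, h1, h2⟩ := ih t' (by omega)
    exact ⟨(a, b) ::ₘ c, by simp [h1], by simpa using h2⟩

lemma row_count {α β : Type*} (c : Multiset (α × β)) (I : α) :
    {K | c.count (I, K) ≠ 0}.Finite ∧ ∑ᶠ K, c.count (I, K) = (c.map Prod.fst).count I := by
  have hfin : ∀ c : Multiset (α × β), {K | c.count (I, K) ≠ 0}.Finite := by
    intro c
    refine (c.map Prod.snd).toFinset.finite_toSet.subset ?_
    intro K hK
    have : (I, K) ∈ c := Multiset.count_ne_zero.1 hK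
    simp only [Finset.mem_coe, Multiset.mem_toFinset, Multiset.mem_map]
    exact ⟨_, this, rfl⟩
  refine ⟨hfin c, ?_⟩
  induction c using Multiset.induction with
  | empty => simp
  | cons p c ih =>
    simp only [Multiset.count_cons, Multiset.map_cons]
    rw [finsum_add_distrib (hfin c), ih]
    · congr 1
      rw [finsum_eq_single _ p.2]
      · by_cases h : I = p.1
        · subst h; simp
        · have : (I, p.2) ≠ p := fun h' => h (by rw [← h'])
          simp [h, this]
      · intro x hx
        have : (I, x) ≠ p := fun h' => hx (by rw [← h'])
        simp [this]
    · refine (Set.finite_singleton p.2).subset ?_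
      intro K hK
      by_contra h
      have : (I, K) ≠ p := fun h' => h (by rw [← h']; rfl)
      simp [this] at hK

lemma col_count {α β : Type*} (c : Multiset (α × β)) (K : β) :
    {I | c.count (I, K) ≠ 0}.Finite ∧ ∑ᶠ I, c.count (I, K) = (c.map Prod.snd).count K := by
  have h := row_count (c.map Prod.swap) K
  have e : ∀ I, (c.map Prod.swap).count (K, I) = c.count (I, K) := by
    intro I
    exact Multiset.count_map_eq_count' Prod.swap c Prod.swap_injective (I, K)
  simp only [e] at h
  simpa using h

lemma exists_multiset {α : Type*} (f : α → ℕ) (hf : {a | f a ≠ 0}.Finite) :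
    ∃ s : Multiset α, (∀ a, s.count a = f a) ∧ s.card = ∑ᶠ a, f a := by
  refine ⟨Finsupp.toMultiset (Finsupp.ofSupportFinite f hf), ?_, ?_⟩
  · intro a; rw [Finsupp.count_toMultiset]; rfl
  · rw [Finsupp.card_toMultiset, Finsupp.sum]
    rw [finsum_eq_sum_of_support_subset (s := (Finsupp.ofSupportFinite f hf).support)]
    · rfl
    · intro x hx; exact Finsupp.mem_support_iff.2 hx

/-- Coupling of two finitely supported functions. -/
lemma coupling {α β : Type*} (f : α → ℕ) (g : β → ℕ) (hf : {a | f a ≠ 0}.Finite)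
    (hg : {a | g a ≠ 0}.Finite) :
    ∃ c : α → β → ℕ, (∀ a, {b | c a b ≠ 0}.Finite) ∧ (∀ b, {a | c a b ≠ 0}.Finite) ∧
      (∀ a, ∑ᶠ b, c a b ≤ f a) ∧ (∀ b, ∑ᶠ a, c a b ≤ g b) ∧
      (∀ a, ∑ᶠ b, c a b < f a → ∑ᶠ b, g b < ∑ᶠ a, f a) ∧
      (∀ b, ∑ᶠ a, c a b < g b → ∑ᶠ a, f a < ∑ᶠ b, g b) := by
  obtain ⟨s, hs, hs'⟩ := exists_multiset f hf
  obtain ⟨t, ht, ht'⟩ := exists_multiset g hg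
  rw [← hs', ← ht']
  simp only [← hs, ← ht]
  rcases le_total s.card t.card with h | h
  · obtain ⟨c, h1, h2⟩ := coupling_multiset s t h
    have h2' := fun b => Multiset.count_le_of_le b h2
    refine ⟨fun a b => c.count (a, b), fun a => (row_count c a).1, fun b => (col_count c b).1,
      fun a => ?_, fun b => ?_, fun a => ?_, fun b => ?_⟩
    · rw [(row_count c a).2, h1]
    · rw [(col_count c b).2]; exact h2' b
    · rw [(row_count c a).2, h1]; intro h; omega
    · rw [(col_count c b).2]
      intro hb
      have hlt : c.map Prod.snd < t := lt_of_le_of_ne h2 (by rintro h; rw [h] at hb; omega)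
      have := Multiset.card_lt_card hlt
      rw [Multiset.card_map] at this
      rw [← h1, Multiset.card_map]; exact this
  · obtain ⟨c, h1, h2⟩ := coupling_multiset t s h
    have h2' := fun b => Multiset.count_le_of_le b h2
    refine ⟨fun a b => c.count (b, a), fun a => (col_count c a).1, fun b => (row_count c b).1,
      fun a => ?_, fun b => ?_, fun a => ?_, fun b => ?_⟩
    · rw [(col_count c a).2]; exact h2' a
    · rw [(row_count c b).2, h1]
    · rw [(col_count c a).2]
      intro hb
      have hlt : c.map Prod.snd < s := lt_of_le_of_ne h2 (by rintro h; rw [h] at hb; omega)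
      have := Multiset.card_lt_card hlt
      rw [Multiset.card_map] at this
      rw [← h1, Multiset.card_map]; exact this
    · rw [(row_count c b).2, h1]; intro h; omega

lemma single_le_finsum_nat {α : Type*} (f : α → ℕ) (hf : {a | f a ≠ 0}.Finite) (a : α) :
    f a ≤ ∑ᶠ a, f a := by
  rw [finsum_eq_sum f hf]
  by_cases h : f a = 0
  · omega
  · exact Finset.single_le_sum (f := f) (fun _ _ => Nat.zero_le _) (hf.mem_toFinset.2 h)

lemma comp_row {α β γ : Type*} (m : α → β → ℕ) (c : β → α → γ → ℕ) (I : α)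
    (hm : {J | m I J ≠ 0}.Finite) (hc : ∀ J, {K | c J I K ≠ 0}.Finite)
    (hle : ∀ J, ∑ᶠ K, c J I K ≤ m I J) :
    {K | ∑ᶠ J, c J I K ≠ 0}.Finite ∧
    (∑ᶠ K, ∑ᶠ J, c J I K ≤ ∑ᶠ J, m I J) ∧
    (∑ᶠ K, ∑ᶠ J, c J I K < ∑ᶠ J, m I J → ∃ J, ∑ᶠ K, c J I K < m I J) := by
  have hcm : ∀ J K, c J I K ≤ m I J := fun J K =>
    (single_le_finsum_nat (fun K => c J I K) (hc J) K).trans (hle J)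
  have e1 : ∀ K, ∑ᶠ J, c J I K = ∑ J ∈ hm.toFinset, c J I K := by
    intro K
    apply finsum_eq_sum_of_support_subset
    intro J hJ
    have := hcm J K
    simp only [Function.mem_support] at hJ
    refine hm.mem_toFinset.2 (show m I J ≠ 0 from ?_)
    omega
  let S : Finset γ := hm.toFinset.biUnion fun J => (hc J).toFinset
  have hsupp : ∀ K, ∑ᶠ J, c J I K ≠ 0 → K ∈ S := by
    intro K hK
    rw [e1] at hK
    obtain ⟨J, hJ, hJ'⟩ := Finset.exists_ne_zero_of_sum_ne_zero hK
    exact Finset.mem_biUnion.2 ⟨J, hJ, by simpa using hJ'⟩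
  have e2 : ∀ J ∈ hm.toFinset, ∑ᶠ K, c J I K = ∑ K ∈ S, c J I K := by
    intro J hJ
    apply finsum_eq_sum_of_support_subset
    intro K hK
    exact Finset.mem_biUnion.2 ⟨J, hJ, by simpa using hK⟩
  have e3 : ∑ᶠ K, ∑ᶠ J, c J I K = ∑ J ∈ hm.toFinset, ∑ᶠ K, c J I K := by
    rw [finsum_eq_sum_of_support_subset (s := S) _ (fun K hK => hsupp K hK)]
    rw [Finset.sum_congr rfl e2, Finset.sum_comm]
    exact Finset.sum_congr rfl fun K _ => e1 K
  have e4 : ∑ᶠ J, m I J = ∑ J ∈ hm.toFinset, m I J := finsum_eq_sum _ hm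
  refine ⟨S.finite_toSet.subset hsupp, ?_, ?_⟩
  · rw [e3, e4]; exact Finset.sum_le_sum fun J _ => hle J
  · rw [e3, e4]; intro h
    obtain ⟨J, _, hJ⟩ := Finset.exists_lt_of_sum_lt h
    exact ⟨J, hJ⟩

lemma len_le_iff (I : Bar) (c : ℝ) : I.len ≤ (c : EReal) ↔ I.2 ≤ ((I.1 + c : ℝ) : EReal) := by
  rw [Bar.len, EReal.sub_le_iff_le_add (Or.inl (EReal.coe_ne_bot _)) (Or.inl (EReal.coe_ne_top _)),
    EReal.coe_add, add_comm]

lemma barSub_trans {I J K : Bar} {δ δ' : ℝ} (h : barSub I J δ) (h' : barSub J K δ') :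
    barSub I K (δ + δ') := by
  refine ⟨by linarith [h.1, h'.1], h.2.trans ?_⟩
  rw [EReal.coe_add, add_comm (δ : EReal), ← add_assoc]
  gcongr
  exact h'.2

lemma barSub_len {I J : Bar} {δ c : ℝ} (h : barSub I J δ) (hJ : J.len ≤ ((2 * c : ℝ) : EReal)) :
    I.len ≤ ((2 * (δ + c) : ℝ) : EReal) := by
  rw [len_le_iff] at *
  calc I.2 ≤ J.2 + (δ : EReal) := h.2
    _ ≤ ((J.1 + 2 * c : ℝ) : EReal) + (δ : EReal) := by gcongr
    _ = ((J.1 + 2 * c + δ : ℝ) : EReal) := (EReal.coe_add _ _).symm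
    _ ≤ _ := by
      rw [EReal.coe_le_coe_iff]; linarith [h.1]

namespace Barcode

lemma HasMatching.symm {B B' : Barcode} {δ : ℝ} (h : HasMatching B B' δ) :
    HasMatching B' B δ := by
  obtain ⟨m, h1, h2, h3, h4, h5, h6, h7⟩ := h
  exact ⟨fun I J => m J I, h2, h1, h4, h3, h6, h5, fun I J h => (h7 J I h).symm⟩

lemma HasMatching.mono {B B' : Barcode} {δ δ' : ℝ} (h : HasMatching B B' δ) (hd : δ ≤ δ') :
    HasMatching B B' δ' := by
  obtain ⟨m, h1, h2, h3, h4, h5, h6, h7⟩ := h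
  have e : ((2 * δ : ℝ) : EReal) ≤ ((2 * δ' : ℝ) : EReal) := by
    rw [EReal.coe_le_coe_iff]; linarith
  have e' : ∀ I J, barSub I J δ → barSub I J δ' := by
    intro I J h
    refine ⟨by linarith [h.1], h.2.trans ?_⟩
    gcongr
  exact ⟨m, h1, h2, h3, h4, fun I h => (h5 I h).trans e, fun I h => (h6 I h).trans e,
    fun I J h => ⟨e' _ _ (h7 I J h).1, e' _ _ (h7 I J h).2⟩⟩

lemma HasMatching.trans {B B' B'' : Barcode} {δ δ' : ℝ} (hδ : 0 ≤ δ) (hδ' : 0 ≤ δ')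
    (h : HasMatching B B' δ) (h' : HasMatching B' B'' δ') :
    HasMatching B B'' (δ + δ') := by
  obtain ⟨m, h1, h2, h3, h4, h5, h6, h7⟩ := h
  obtain ⟨m', h1', h2', h3', h4', h5', h6', h7'⟩ := h'
  choose c c1 c2 c3 c4 c5 c6 using fun J => coupling (fun I => m I J) (fun K => m' J K) (h2 J) (h1' J)
  have R := fun I => comp_row m c I (h1 I) (fun J => c1 J I) (fun J => c3 J I)
  have C := fun K => comp_row (fun K J => m' J K) (fun J K I => c J I K) K (h2' K)
    (fun J => c2 J K) (fun J => c4 J K)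
  refine ⟨fun I K => ∑ᶠ J, c J I K, fun I => (R I).1, fun K => (C K).1,
    fun I => (R I).2.1.trans (h3 I), fun K => (C K).2.1.trans (h4' K), ?_, ?_, ?_⟩
  · intro I hI
    beta_reduce at hI
    by_cases hm : ∑ᶠ J, m I J < B.mult I
    · refine (h5 I hm).trans ?_
      rw [EReal.coe_le_coe_iff]; linarith
    · obtain ⟨J, hJ⟩ := (R I).2.2 (by omega)
      have a := h5' J (lt_of_lt_of_le (c5 J I hJ) (h4 J))
      exact barSub_len (h7 I J (by omega)).1 a
  · intro K hK
    beta_reduce at hK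
    by_cases hm : ∑ᶠ J, m' J K < B''.mult K
    · refine (h6' K hm).trans ?_
      rw [EReal.coe_le_coe_iff]; linarith
    · obtain ⟨J, hJ⟩ := (C K).2.2 (by omega)
      have a := h6 J (lt_of_lt_of_le (c6 J K hJ) (h3' J))
      rw [add_comm δ δ']
      exact barSub_len (h7' J K (by omega)).2 a
  · intro I K hIK
    obtain ⟨J, hJ⟩ : ∃ J, c J I K ≠ 0 := by
      by_contra! h
      simp [h] at hIK
    have a1 := (single_le_finsum_nat (fun K => c J I K) (c1 J I) K).trans (c3 J I)
    have a2 := (single_le_finsum_nat (fun I => c J I K) (c2 J K) I).trans (c4 J K)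
    have b1 := h7 I J (by omega)
    have b2 := h7' J K (by omega)
    refine ⟨barSub_trans b1.1 b2.1, ?_⟩
    rw [add_comm δ δ']
    exact barSub_trans b2.2 b1.2

/-- Pushforward of a finite weighted set of bars. -/
lemma hasMatching_push {B B' : Barcode} {δ : ℝ} (S : Finset Bar) (w : Bar → ℕ) (φ ψ : Bar → Bar)
    (hB : ∀ J, B.mult J = ∑ I ∈ S, if φ I = J then w I else 0)
    (hB' : ∀ J, B'.mult J = ∑ I ∈ S, if ψ I = J then w I else 0)
    (hc : ∀ I ∈ S, barSub (φ I) (ψ I) δ ∧ barSub (ψ I) (φ I) δ) :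
    HasMatching B B' δ := by
  let m : Bar → Bar → ℕ := fun J K => ∑ I ∈ S, if φ I = J ∧ ψ I = K then w I else 0
  have hm : ∀ J K, m J K ≠ 0 → ∃ I ∈ S, φ I = J ∧ ψ I = K := by
    intro J K h
    obtain ⟨I, hI, h'⟩ := Finset.exists_ne_zero_of_sum_ne_zero h
    refine ⟨I, hI, ?_⟩
    by_contra hn
    simp [hn] at h'
  have r1 : ∀ J K, m J K ≠ 0 → K ∈ S.image ψ := fun J K h => by
    obtain ⟨I, hI, _, h⟩ := hm J K h
    exact Finset.mem_image.2 ⟨I, hI, h⟩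
  have r2 : ∀ J K, m J K ≠ 0 → J ∈ S.image φ := fun J K h => by
    obtain ⟨I, hI, h, _⟩ := hm J K h
    exact Finset.mem_image.2 ⟨I, hI, h⟩
  have s1 : ∀ J, ∑ᶠ K, m J K = B.mult J := by
    intro J
    rw [finsum_eq_sum_of_support_subset _ (s := S.image ψ) (fun K hK => r1 J K hK), hB,
      Finset.sum_comm]
    refine Finset.sum_congr rfl fun I hI => ?_
    simp only [ite_and]
    split_ifs
    · rw [Finset.sum_ite_eq, if_pos (Finset.mem_image_of_mem _ hI)]
    · simp
  have s2 : ∀ K, ∑ᶠ J, m J K = B'.mult K := by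
    intro K
    rw [finsum_eq_sum_of_support_subset _ (s := S.image φ) (fun J hJ => r2 J K hJ), hB',
      Finset.sum_comm]
    refine Finset.sum_congr rfl fun I hI => ?_
    simp only [ite_and]
    split_ifs
    · rw [Finset.sum_ite_eq, if_pos (Finset.mem_image_of_mem _ hI)]
    · simp
  refine ⟨m, fun J => (S.image ψ).finite_toSet.subset (r1 J),
    fun K => (S.image φ).finite_toSet.subset (fun J hJ => r2 J K hJ),
    fun J => (s1 J).le, fun K => (s2 K).le, fun J h => ?_, fun J h => ?_, ?_⟩
  · rw [s1] at h; omega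
  · rw [s2] at h; omega
  · intro J K h
    obtain ⟨I, hI, rfl, rfl⟩ := hm J K h
    exact hc I hI

/-- Shrink every bar by `t` at both ends. -/
def shrink (B : Barcode) (t : ℝ) : Barcode where
  mult I := if I.IsValid then B.mult (I.1 - t, I.2 + (t : EReal)) else 0
  valid I h := by
    by_contra hn
    simp [hn] at h

lemma ereal_cancel (b : EReal) (t : ℝ) : b + (t : EReal) + ((-t : ℝ) : EReal) = b := by
  rw [add_assoc, ← EReal.coe_add]; simp

lemma ereal_cancel' (b : EReal) (t : ℝ) : b + ((-t : ℝ) : EReal) + (t : EReal) = b := by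
  rw [add_assoc, ← EReal.coe_add]; simp

lemma hasMatching_shrink (B : Barcode) {δ t s : ℝ} (ht : t ≤ s) (hs : s - t = δ) :
    HasMatching (B.shrink t) (B.shrink s) δ := by
  have hst : s = t + δ := by linarith
  subst hst
  have hδ : 0 ≤ δ := by linarith
  let up : Bar → Bar := fun J => (J.1 - δ, J.2 + (δ : EReal))
  let dn : Bar → Bar := fun J => (J.1 + δ, J.2 + ((-δ : ℝ) : EReal))
  have ud : ∀ J, up (dn J) = J := fun J => by
    simp only [up, dn]; rw [ereal_cancel']; simp
  have du : ∀ J, dn (up J) = J := fun J => by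
    simp only [up, dn]; rw [ereal_cancel]; simp
  have hv : ∀ J : Bar, J.IsValid → (up J).IsValid := by
    intro J hJ
    simp only [Bar.IsValid, up] at *
    calc ((J.1 - δ : ℝ) : EReal) ≤ J.1 := by rw [EReal.coe_le_coe_iff]; linarith
      _ < J.2 := hJ
      _ = J.2 + ((0 : ℝ) : EReal) := by simp
      _ ≤ _ := by gcongr
  have hmul : ∀ J, J.IsValid → (B.shrink (t + δ)).mult J = (B.shrink t).mult (up J) := by
    intro J hJ
    simp only [shrink, if_pos hJ, if_pos (hv J hJ), up]
    congr 2
    · ring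
    · rw [EReal.coe_add, add_assoc, add_comm (δ : EReal)]
  let m : Bar → Bar → ℕ := fun I J => if I = up J then (B.shrink (t + δ)).mult J else 0
  have m1 : ∀ I J, m I J ≠ 0 → J = dn I := by
    intro I J h
    by_cases h' : I = up J
    · rw [h', du]
    · simp [m, h'] at h
  have m2 : ∀ I J, m I J ≠ 0 → I = up J := by
    intro I J h
    by_contra h'
    simp [m, h'] at h
  have s1 : ∀ I, ∑ᶠ J, m I J = (B.shrink (t + δ)).mult (dn I) := by
    intro I
    rw [finsum_eq_single _ (dn I)]
    · simp [m, ud]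
    · intro J hJ
      by_contra h
      exact hJ (m1 I J h)
  have s2 : ∀ J, ∑ᶠ I, m I J = (B.shrink (t + δ)).mult J := by
    intro J
    rw [finsum_eq_single _ (up J)]
    · simp [m]
    · intro I hI
      by_contra h
      exact hI (m2 I J h)
  refine ⟨m, fun I => (Set.finite_singleton (dn I)).subset (m1 I),
    fun J => (Set.finite_singleton (up J)).subset (fun I h => m2 I J h), ?_,
    fun J => (s2 J).le, ?_, ?_, ?_⟩
  · intro I
    rw [s1]
    by_cases h : (dn I).IsValid
    · rw [hmul _ h, ud]
    · simp [shrink, h]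
  · intro I
    rw [s1]
    by_cases h : (dn I).IsValid
    · rw [hmul _ h, ud]; intro h; omega
    · intro _
      rw [len_le_iff]
      simp only [Bar.IsValid, dn, not_lt] at h
      have : I.2 + ((-δ : ℝ) : EReal) + (δ : EReal) ≤ ((I.1 + δ : ℝ) : EReal) + (δ : EReal) := by
        gcongr
      rw [ereal_cancel', ← EReal.coe_add] at this
      convert this using 2
      ring
  · intro J h
    rw [s2] at h; omega
  · intro I J h
    rw [m2 I J h]
    refine ⟨⟨by simp [up], by simp [up]⟩, ⟨by simp only [up]; linarith, ?_⟩⟩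
    simp only [up]
    calc J.2 = J.2 + ((0 : ℝ) : EReal) + ((0 : ℝ) : EReal) := by simp
      _ ≤ _ := by gcongr

lemma hasMatching_refl (B : Barcode) : HasMatching B B 0 := by
  have : B.shrink 0 = B := by
    cases B with
    | mk w h =>
      simp only [shrink, mk.injEq]
      funext I
      by_cases hI : I.IsValid
      · simp [hI]
      · by_contra h'
        simp only [hI, if_false] at h'
        exact hI (h I (Ne.symm h'))
  have h := hasMatching_shrink B (le_refl 0) (sub_self (0 : ℝ))
  rwa [this] at h

lemma row_inf {B B' : Barcode} {δ : ℝ} {m : Bar → Bar → ℕ} (h : IsMatching B B' δ m)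
    (S' : Finset Bar) (hS' : ∀ J, J.IsInf → B'.mult J ≠ 0 → J ∈ S') (I : Bar) (hI : I.IsInf) :
    B.mult I = ∑ J ∈ S', m I J := by
  obtain ⟨h1, h2, h3, h4, h5, h6, h7⟩ := h
  have hI' : I.2 = ⊤ := hI
  have e : ∑ᶠ J, m I J = B.mult I := by
    refine le_antisymm (h3 I) (not_lt.1 fun h => ?_)
    have := h5 I h
    rw [len_le_iff, hI', top_le_iff] at this
    exact EReal.coe_ne_top _ this
  rw [← e]
  apply finsum_eq_sum_of_support_subset
  intro J hJ
  refine hS' J ?_ ?_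
  · have := (h7 I J hJ).1.2
    rw [hI', top_le_iff] at this
    by_contra hn
    exact (EReal.add_lt_top hn (EReal.coe_ne_top δ)).ne this
  · have := (single_le_finsum_nat (fun I => m I J) (h2 J) I).trans (h4 J)
    simp only [Function.mem_support] at hJ this
    omega

lemma HasMatching.inf_eq {B B' : Barcode} {δ : ℝ} (h : HasMatching B B' δ)
    (hB : {I | I.IsInf ∧ B.mult I ≠ 0}.Finite) (hB' : {I | I.IsInf ∧ B'.mult I ≠ 0}.Finite) :
    ∑ᶠ (I : Bar) (_ : I.IsInf), B.mult I = ∑ᶠ (I : Bar) (_ : I.IsInf), B'.mult I := by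
  obtain ⟨m, h⟩ := h
  have e : ∑ᶠ (I : Bar) (_ : I.IsInf), B.mult I = ∑ I ∈ hB.toFinset, B.mult I :=
    finsum_cond_eq_sum_of_cond_iff _ (fun {x} hx => by simp [hx])
  have e' : ∑ᶠ (I : Bar) (_ : I.IsInf), B'.mult I = ∑ I ∈ hB'.toFinset, B'.mult I :=
    finsum_cond_eq_sum_of_cond_iff _ (fun {x} hx => by simp [hx])
  rw [e, e']
  have hT : IsMatching B' B δ (fun I J => m J I) := by
    obtain ⟨h1, h2, h3, h4, h5, h6, h7⟩ := h
    exact ⟨h2, h1, h4, h3, h6, h5, fun I J h => (h7 J I h).symm⟩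
  rw [Finset.sum_congr rfl fun I hI => row_inf h hB'.toFinset
      (fun J a b => by simpa using ⟨a, b⟩) I (by simp at hI; exact hI.1),
    Finset.sum_congr rfl fun I hI => row_inf hT hB.toFinset
      (fun J a b => by simpa using ⟨a, b⟩) I (by simp at hI; exact hI.1)]
  exact Finset.sum_comm

end Barcode

lemma barcode_ext {B B' : Barcode} (h : B.mult = B'.mult) : B = B' := by
  cases B
  cases B'
  simpa using h

lemma dist_lt_iff (B B' : GradedBarcode) (ε : ℝ) :
    GradedBarcode.dist B B' < (ε : EReal) ↔
      ∃ r : ℝ, 0 ≤ r ∧ r < ε ∧ ∀ n, Barcode.HasMatching (B n) (B' n) r := by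
  constructor
  · intro h
    obtain ⟨r, h1, h2⟩ := EReal.lt_iff_exists_real_btwn.1 h
    have key : ∀ n, ∃ δ : ℝ, 0 ≤ δ ∧ δ < r ∧ Barcode.HasMatching (B n) (B' n) δ := by
      intro n
      have : Barcode.bottleneck (B n) (B' n) < (r : EReal) :=
        lt_of_le_of_lt (le_iSup (fun n => Barcode.bottleneck (B n) (B' n)) n) h1
      obtain ⟨x, ⟨δ, hδ, rfl, hm⟩, hx⟩ := sInf_lt_iff.1 this
      exact ⟨δ, hδ, EReal.coe_lt_coe_iff.1 hx, hm⟩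
    refine ⟨r, ?_, EReal.coe_lt_coe_iff.1 h2, fun n => ?_⟩
    · obtain ⟨δ, a, b, _⟩ := key 0
      linarith
    · obtain ⟨δ, a, b, h⟩ := key n
      exact h.mono b.le
  · rintro ⟨r, h0, h1, h2⟩
    refine lt_of_le_of_lt (iSup_le fun n => ?_) (EReal.coe_lt_coe_iff.2 h1)
    exact sInf_le ⟨r, h0, rfl, h2 n⟩

lemma joined_of_lipschitz (γ : ℝ → QTGB) (C : ℝ) (hC : 0 ≤ C)
    (h : ∀ s t : ℝ, 0 ≤ s → s ≤ t → t ≤ 1 →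
      ∀ n, Barcode.HasMatching ((γ s).1 n) ((γ t).1 n) (C * (t - s))) :
    Joined (γ 0) (γ 1) := by
  have h' : ∀ s t : unitInterval, ∀ n,
      Barcode.HasMatching ((γ s).1 n) ((γ t).1 n) (C * |(t : ℝ) - s|) := by
    intro s t n
    rcases le_total (s : ℝ) t with hst | hst
    · rw [abs_of_nonneg (by linarith)]
      exact h s t s.2.1 hst t.2.2 n
    · rw [abs_of_nonpos (by linarith), neg_sub]
      exact (h t s t.2.1 hst s.2.2 n).symm
  have hcont : Continuous (fun t : unitInterval => γ t) := by
    refine continuous_generateFrom_iff.2 ?_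
    rintro _ ⟨B, ε, hε, rfl⟩
    rw [Metric.isOpen_iff]
    intro s hs
    obtain ⟨r, h0, h1, h2⟩ := (dist_lt_iff _ _ _).1 hs
    refine ⟨(ε - r) / (C + 1), div_pos (by linarith) (by linarith), ?_⟩
    intro t ht
    refine (dist_lt_iff _ _ _).2 ⟨r + C * |(t : ℝ) - s|, by positivity, ?_, fun n =>
      (h2 n).trans h0 (by positivity) (h' s t n)⟩
    rw [Metric.mem_ball, Subtype.dist_eq, Real.dist_eq, lt_div_iff₀ (by linarith)] at ht
    nlinarith [abs_nonneg ((t : ℝ) - s)]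
  exact ⟨⟨⟨_, hcont⟩, by simp, by simp⟩⟩

lemma finite_inf (B : QTGB) (n : ℤ) : {I | I.IsInf ∧ (B.1 n).mult I ≠ 0}.Finite := by
  have h := B.2 1 one_pos
  refine (h.image Prod.snd).subset ?_
  rintro I ⟨hI, hI'⟩
  refine ⟨(n, I), ⟨hI', ?_⟩, rfl⟩
  have : I.2 = ⊤ := hI
  simp [Bar.len, this]

lemma sigmaInf_eq_of_matching (B B' : QTGB) (r : ℝ) (n : ℤ)
    (h : Barcode.HasMatching (B.1 n) (B'.1 n) r) : B.1.sigmaInf n = B'.1.sigmaInf n :=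
  h.inf_eq (finite_inf B n) (finite_inf B' n)

lemma sigmaInf_continuous (n : ℤ) : Continuous (fun B : QTGB => B.1.sigmaInf n) := by
  refine IsLocallyConstant.continuous ?_
  rw [IsLocallyConstant.iff_exists_open]
  intro B
  refine ⟨{B' : QTGB | GradedBarcode.dist B.1 B'.1 < ((1 : ℝ) : EReal)},
    TopologicalSpace.isOpen_generateFrom_of_mem ⟨B, 1, one_pos, rfl⟩, ?_, ?_⟩
  · exact (dist_lt_iff _ _ _).2 ⟨0, le_rfl, one_pos, fun n => Barcode.hasMatching_refl _⟩
  · intro B' hB'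
    obtain ⟨r, _, _, h⟩ := (dist_lt_iff _ _ _).1 hB'
    exact (sigmaInf_eq_of_matching B B' r n (h n)).symm

lemma sigmaInf_eq_of_component (B B' : QTGB) (h : connectedComponent B = connectedComponent B')
    (n : ℤ) : B.1.sigmaInf n = B'.1.sigmaInf n :=
  (sigmaInf_continuous n).image_eq_of_connectedComponent_eq B B' h

/-- Graded version of shrinking. -/
def gshrink (B : QTGB) (t : ℝ) (ht : 0 ≤ t) : QTGB :=
  ⟨fun n => (B.1 n).shrink t, by
    intro ε hε
    refine ((B.2 ε hε).image
      (fun p => (p.1, (p.2.1 + t, p.2.2 + ((-t : ℝ) : EReal))))).subset ?_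
    rintro ⟨n, I⟩ ⟨h1, h2⟩
    refine ⟨(n, (I.1 - t, I.2 + (t : EReal))), ⟨?_, ?_⟩, ?_⟩
    · intro h
      simp only [Barcode.shrink] at h1
      exact h1 (by simp only at h; simp [h])
    · refine le_trans h2 ?_
      simp only [Bar.len]
      refine EReal.sub_le_sub ?_ ?_
      · calc I.2 = I.2 + ((0 : ℝ) : EReal) := by simp
          _ ≤ _ := by gcongr
      · rw [EReal.coe_le_coe_iff]; linarith
    · simp only [Barcode.ereal_cancel]
      simp⟩

lemma shrink_zero (B : Barcode) : B.shrink 0 = B := by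
  cases B with
  | mk w h =>
    simp only [Barcode.shrink, Barcode.mk.injEq]
    funext I
    by_cases hI : I.IsValid
    · simp [hI]
    · by_contra h'
      simp only [hI, if_false] at h'
      exact hI (h I (Ne.symm h'))

lemma joined_gshrink (B : QTGB) (T : ℝ) (hT : 0 ≤ T) : Joined B (gshrink B T hT) := by
  have h := joined_of_lipschitz (fun t => gshrink B (max t 0 * T) (by positivity)) T hT ?_
  · convert h using 1
    · apply Subtype.ext
      funext n
      simp [gshrink, shrink_zero]
    · simp
  · intro s t hs hst ht n
    simp only [gshrink]
    rw [max_eq_left hs, max_eq_left (hs.trans hst)]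
    exact Barcode.hasMatching_shrink _ (by nlinarith) (by ring)

/-- Shrinking enough kills all the finite bars. -/
lemma exists_joined_inf (B : QTGB) :
    ∃ E : QTGB, Joined B E ∧ ∀ n I, (E.1 n).mult I ≠ 0 → I.IsInf := by
  have hfin := B.2 1 one_pos
  obtain ⟨T, hT⟩ : ∃ T : ℝ, ∀ p ∈ hfin.toFinset, p.2.len.toReal ≤ T := by
    obtain ⟨T, hT⟩ := (hfin.toFinset.image fun p => p.2.len.toReal).bddAbove
    exact ⟨T, fun p hp => hT (Finset.mem_coe.2 (Finset.mem_image_of_mem _ hp))⟩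
  have hpos : 0 ≤ max T 1 := le_trans zero_le_one (le_max_right _ _)
  refine ⟨gshrink B (max T 1) hpos, joined_gshrink B _ hpos, ?_⟩
  rintro n ⟨a, b⟩ hI
  have hval := ((gshrink B (max T 1) hpos).1 n).valid _ hI
  have hm : (B.1 n).mult (a - max T 1, b + ((max T 1 : ℝ) : EReal)) ≠ 0 := by
    intro h
    apply hI
    simp only [gshrink, Barcode.shrink, h, ite_self]
  by_contra hinf
  simp only [Bar.IsInf] at hinf
  simp only [Bar.IsValid] at hval
  induction b with
  | bot => simp at hval
  | top => exact hinf rfl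
  | coe b =>
    rw [EReal.coe_lt_coe_iff] at hval
    set M := max T 1
    have hM : 1 ≤ M := le_max_right _ _
    have hl : Bar.len (a - M, (b : EReal) + (M : EReal)) = ((b + M - (a - M) : ℝ) : EReal) := by
      simp only [Bar.len, EReal.coe_sub, EReal.coe_add]
    have := hT (n, (a - M, (b : EReal) + (M : EReal))) (hfin.mem_toFinset.2 ⟨hm, by
      rw [hl, EReal.coe_le_coe_iff]; linarith⟩)
    rw [hl, EReal.toReal_coe] at this
    have : T ≤ M := le_max_left _ _
    linarith

lemma exists_joined_std (B : QTGB) (hB : ∀ n I, (B.1 n).mult I ≠ 0 → I.IsInf) :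
    ∃ E : QTGB, Joined B E ∧ ∀ n I, (E.1 n).mult I ≠ 0 → I = (0, ⊤) := by
  have hfin : {p : ℤ × Bar | (B.1 p.1).mult p.2 ≠ 0}.Finite := by
    refine (B.2 1 one_pos).subset ?_
    rintro ⟨n, I⟩ h
    refine ⟨h, ?_⟩
    have : I.2 = ⊤ := hB n I h
    simp [Bar.len, this]
  have hn : ∀ n, {I | (B.1 n).mult I ≠ 0}.Finite := by
    intro n
    refine (hfin.image Prod.snd).subset ?_
    intro I hI
    exact ⟨(n, I), hI, rfl⟩
  obtain ⟨R, hR⟩ : ∃ R : ℝ, ∀ p ∈ hfin.toFinset, |p.2.1| ≤ R := by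
    obtain ⟨T, hT⟩ := (hfin.toFinset.image fun p => |p.2.1|).bddAbove
    exact ⟨T, fun p hp => hT (Finset.mem_coe.2 (Finset.mem_image_of_mem _ hp))⟩
  have hR' : ∀ n I, (B.1 n).mult I ≠ 0 → |I.1| ≤ max R 0 := fun n I h =>
    (hR (n, I) (hfin.mem_toFinset.2 h)).trans (le_max_left _ _)
  let φ : ℝ → Bar → Bar := fun t I => ((1 - t) * I.1, ⊤)
  let W : ℝ → ℤ → Bar → ℕ := fun t n J =>
    ∑ I ∈ (hn n).toFinset, if φ t I = J then (B.1 n).mult I else 0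
  have hW : ∀ t n J, W t n J ≠ 0 → ∃ I, (B.1 n).mult I ≠ 0 ∧ φ t I = J := by
    intro t n J h
    obtain ⟨I, hI, h'⟩ := Finset.exists_ne_zero_of_sum_ne_zero h
    refine ⟨I, (hn n).mem_toFinset.1 hI, ?_⟩
    by_contra hne
    simp [hne] at h'
  let γ : ℝ → QTGB := fun t => ⟨fun n => ⟨W t n, by
      intro J hJ
      obtain ⟨I, _, rfl⟩ := hW t n J hJ
      exact EReal.coe_lt_top _⟩, by
    intro ε hε
    refine (hfin.image (fun p => (p.1, φ t p.2))).subset ?_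
    rintro ⟨n, J⟩ ⟨h1, h2⟩
    obtain ⟨I, h3, h4⟩ := hW t n J h1
    exact ⟨(n, I), h3, by simp only [h4]⟩⟩
  have hj : Joined (γ 0) (γ 1) := by
    refine joined_of_lipschitz γ (max R 0) (le_max_right _ _) ?_
    intro s t hs hst ht n
    refine Barcode.hasMatching_push (hn n).toFinset (B.1 n).mult (φ s) (φ t)
      (fun J => rfl) (fun J => rfl) ?_
    intro I hI
    have hI' := abs_le.1 (hR' n I ((hn n).mem_toFinset.1 hI))
    have e1 : (t - s) * I.1 ≤ (t - s) * max R 0 :=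
      mul_le_mul_of_nonneg_left hI'.2 (by linarith)
    have e2 : (t - s) * (- max R 0) ≤ (t - s) * I.1 :=
      mul_le_mul_of_nonneg_left hI'.1 (by linarith)
    refine ⟨⟨?_, ?_⟩, ⟨?_, ?_⟩⟩
    · simp only [φ]; nlinarith
    · simp only [φ]; rw [EReal.top_add_coe]
    · simp only [φ]; nlinarith
    · simp only [φ]; rw [EReal.top_add_coe]
  have h0 : γ 0 = B := by
    apply Subtype.ext
    funext n
    have : (B.1 n).mult = W 0 n := by
      funext J
      have e : ∀ I ∈ (hn n).toFinset, φ 0 I = I := by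
        intro I hI
        have : I.2 = ⊤ := hB n I ((hn n).mem_toFinset.1 hI)
        apply Prod.ext
        · simp [φ]
        · simp [φ, this]
      simp only [W]
      rw [Finset.sum_congr rfl fun I hI => by rw [e I hI], Finset.sum_ite_eq']
      split_ifs with h
      · rfl
      · by_contra h'
        exact h ((hn n).mem_toFinset.2 h')
    exact barcode_ext this.symm
  refine ⟨γ 1, h0 ▸ hj, ?_⟩
  intro n J hJ
  obtain ⟨I, _, rfl⟩ := hW 1 n J hJ
  simp [φ]

lemma sigmaInf_std (E : QTGB) (hE : ∀ n I, (E.1 n).mult I ≠ 0 → I = (0, ⊤)) (n : ℤ) :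
    E.1.sigmaInf n = (E.1 n).mult (0, ⊤) := by
  unfold GradedBarcode.sigmaInf
  rw [finsum_eq_single _ ((0, ⊤) : Bar)]
  · have : Bar.IsInf (0, ⊤) := rfl
    simp [this]
  · intro I hI
    have : (E.1 n).mult I = 0 := by
      by_contra h
      exact hI (hE n I h)
    simp [this]

lemma joined_component {B E : QTGB} (h : Joined B E) :
    connectedComponent B = connectedComponent E :=
  connectedComponent_eq (pathComponent_subset_component B h)

lemma joined_of_sigmaInf_eq (B B' : QTGB) (h : ∀ n, B.1.sigmaInf n = B'.1.sigmaInf n) :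
    Joined B B' := by
  have key : ∀ B : QTGB, ∃ E : QTGB, Joined B E ∧ ∀ n I, (E.1 n).mult I ≠ 0 → I = (0, ⊤) := by
    intro B
    obtain ⟨E, h1, h2⟩ := exists_joined_inf B
    obtain ⟨F, h3, h4⟩ := exists_joined_std E h2
    exact ⟨F, h1.trans h3, h4⟩
  obtain ⟨E, h1, h2⟩ := key B
  obtain ⟨E', h1', h2'⟩ := key B'
  have : E = E' := by
    apply Subtype.ext
    funext n
    have e : (E.1 n).mult = (E'.1 n).mult := by
      funext I
      by_cases hI : I = (0, ⊤)
      · subst hI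
        rw [← sigmaInf_std E h2, ← sigmaInf_std E' h2',
          ← sigmaInf_eq_of_component _ _ (joined_component h1),
          ← sigmaInf_eq_of_component _ _ (joined_component h1'), h]
      · have a : (E.1 n).mult I = 0 := by
          by_contra h; exact hI (h2 n I h)
        have a' : (E'.1 n).mult I = 0 := by
          by_contra h; exact hI (h2' n I h)
        rw [a, a']
    cases hE : E.1 n
    cases hE' : E'.1 n
    rw [hE, hE'] at e
    simpa using e
  subst this
  exact h1.trans h1'.symm

/-- Two q-tame graded barcodes lie in the same connected component of the
space of q-tame graded barcodes iff they have the same number of semi-infinite bars in each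
degree; moreover every connected component is path-connected. -/
theorem connectedComponent_eq_iff_sigmaInf_eq :
    (∀ B B' : QTGB, connectedComponent B = connectedComponent B' ↔
      ∀ n : ℤ, B.1.sigmaInf n = B'.1.sigmaInf n) ∧
    (∀ B : QTGB, IsPathConnected (connectedComponent B)) := by
  refine ⟨fun B B' => ⟨sigmaInf_eq_of_component B B', fun h =>
    joined_component (joined_of_sigmaInf_eq B B' h)⟩, fun B => ?_⟩
  have : connectedComponent B = pathComponent B := by
    refine Set.Subset.antisymm (fun E hE => ?_) (pathComponent_subset_component B)
    exact joined_of_sigmaInf_eq B E (sigmaInf_eq_of_component B E (connectedComponent_eq hE))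
  rw [this]
  exact isPathConnected_pathComponent
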